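/- Global satisfaction is invariant under total surjective bisimulation in hybridised propositional logic (instance of the paper's Corollary 2): let φ : (P,Nom,Λ) → (P',Nom',Λ') be an HPL signature morphism and B a φ-bisimulation between models (M,W) and (M',W') that is total (every world of W is B-related to some world of W') and surjective (every world of W' is B-related to some world of W). Then for every HPL sentence ρ over (P,Nom,Λ), (M,W) globally satisfies ρ if and only if (M',W') globally satisfies Sen(φ)(ρ). -/

import Mathlib

/-- Propositional logic formulas over a set `P` of propositional variables. -/
inductive PLForm (P : Type) : Type where
  | var : P → PLForm P
  | or : PLForm P → PLForm P → PLForm P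
  | and : PLForm P → PLForm P → PLForm P
  | imp : PLForm P → PLForm P → PLForm P
  | neg : PLForm P → PLForm P

/-- Satisfaction of a PL formula by a valuation `M : P → Bool`. -/
def PLSat {P : Type} (M : P → Bool) : PLForm P → Prop
  | .var p => M p = true
  | .or a b => PLSat M a ∨ PLSat M b
  | .and a b => PLSat M a ∧ PLSat M b
  | .imp a b => PLSat M a → PLSat M b
  | .neg a => ¬ PLSat M a

/-- PL sentence translation along a function `φ : P → P'`. -/
def PLTrans {P P' : Type} (φ : P → P') : PLForm P → PLForm P'
  | .var p => .var (φ p)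
  | .or a b => .or (PLTrans φ a) (PLTrans φ b)
  | .and a b => .and (PLTrans φ a) (PLTrans φ b)
  | .imp a b => .imp (PLTrans φ a) (PLTrans φ b)
  | .neg a => .neg (PLTrans φ a)

/-- Sentences of hybrid propositional logic over the signature `(P, Nom, Λ)`,
where `Λ n` is the set of modalities of arity `n + 1` (i.e. taking `n`
sentence arguments). -/
inductive HPLSent (P Nom : Type) (Λ : ℕ → Type) : Type where
  | base : PLForm P → HPLSent P Nom Λ
  | nom : Nom → HPLSent P Nom Λ
  | neg : HPLSent P Nom Λ → HPLSent P Nom Λ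
  | or : HPLSent P Nom Λ → HPLSent P Nom Λ → HPLSent P Nom Λ
  | and : HPLSent P Nom Λ → HPLSent P Nom Λ → HPLSent P Nom Λ
  | imp : HPLSent P Nom Λ → HPLSent P Nom Λ → HPLSent P Nom Λ
  | at : Nom → HPLSent P Nom Λ → HPLSent P Nom Λ
  | dia : {n : ℕ} → Λ n → (Fin n → HPLSent P Nom Λ) → HPLSent P Nom Λ
  | box : {n : ℕ} → Λ n → (Fin n → HPLSent P Nom Λ) → HPLSent P Nom Λ

/-- A model of hybrid propositional logic over `(P, Nom, Λ)`: a Kripke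
structure whose worlds carry propositional valuations. -/
structure HPLModel (P Nom : Type) (Λ : ℕ → Type) : Type 1 where
  W : Type
  nomI : Nom → W
  rel : ∀ {n : ℕ}, Λ n → W → (Fin n → W) → Prop
  val : W → P → Bool

/-- Local satisfaction of an HPL sentence at a world. -/
def HPLSat {P Nom : Type} {Λ : ℕ → Type} (M : HPLModel P Nom Λ) :
    M.W → HPLSent P Nom Λ → Prop
  | w, .base ρ => PLSat (M.val w) ρ
  | w, .nom i => M.nomI i = w
  | w, .neg ρ => ¬ HPLSat M w ρ
  | w, .or ρ ρ' => HPLSat M w ρ ∨ HPLSat M w ρ'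
  | w, .and ρ ρ' => HPLSat M w ρ ∧ HPLSat M w ρ'
  | w, .imp ρ ρ' => HPLSat M w ρ → HPLSat M w ρ'
  | _, .at i ρ => HPLSat M (M.nomI i) ρ
  | w, .dia l ξ => ∃ ws : Fin _ → M.W, M.rel l w ws ∧ ∀ k, HPLSat M (ws k) (ξ k)
  | w, .box l ξ => ∀ ws : Fin _ → M.W, M.rel l w ws → ∃ k, HPLSat M (ws k) (ξ k)

/-- Global satisfaction: satisfaction at every world. -/
def HPLGSat {P Nom : Type} {Λ : ℕ → Type} (M : HPLModel P Nom Λ)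
    (ρ : HPLSent P Nom Λ) : Prop :=
  ∀ w : M.W, HPLSat M w ρ

/-- A signature morphism of hybrid propositional logic. -/
structure HPLMor (P Nom : Type) (Λ : ℕ → Type) (P' Nom' : Type)
    (Λ' : ℕ → Type) : Type where
  sig : P → P'
  nom : Nom → Nom'
  ms : ∀ {n : ℕ}, Λ n → Λ' n

/-- Sentence translation along an HPL signature morphism. -/
def HPLTrans {P Nom : Type} {Λ : ℕ → Type} {P' Nom' : Type} {Λ' : ℕ → Type}
    (φ : HPLMor P Nom Λ P' Nom' Λ') : HPLSent P Nom Λ → HPLSent P' Nom' Λ'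
  | .base ρ => .base (PLTrans φ.sig ρ)
  | .nom i => .nom (φ.nom i)
  | .neg ρ => .neg (HPLTrans φ ρ)
  | .or ρ ρ' => .or (HPLTrans φ ρ) (HPLTrans φ ρ')
  | .and ρ ρ' => .and (HPLTrans φ ρ) (HPLTrans φ ρ')
  | .imp ρ ρ' => .imp (HPLTrans φ ρ) (HPLTrans φ ρ')
  | .at i ρ => .at (φ.nom i) (HPLTrans φ ρ)
  | .dia l ξ => .dia (φ.ms l) (fun k => HPLTrans φ (ξ k))
  | .box l ξ => .box (φ.ms l) (fun k => HPLTrans φ (ξ k))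

/-- Model reduct along an HPL signature morphism. -/
def HPLReduct {P Nom : Type} {Λ : ℕ → Type} {P' Nom' : Type} {Λ' : ℕ → Type}
    (φ : HPLMor P Nom Λ P' Nom' Λ') (M' : HPLModel P' Nom' Λ') :
    HPLModel P Nom Λ where
  W := M'.W
  nomI i := M'.nomI (φ.nom i)
  rel l := M'.rel (φ.ms l)
  val w p := M'.val w (φ.sig p)

/-- A `φ`-bisimulation between HPL models `(M,W)` and `(M',W')`: a non-empty
relation `B` satisfying conditions (i)–(v) of the paper's
Definition of bisimulation (instantiated to HPL, where elementary equivalence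
of local PL models amounts to agreement of valuations up to translation). -/
structure IsHPLBisim {P Nom : Type} {Λ : ℕ → Type} {P' Nom' : Type}
    {Λ' : ℕ → Type} (φ : HPLMor P Nom Λ P' Nom' Λ')
    (M : HPLModel P Nom Λ) (M' : HPLModel P' Nom' Λ')
    (B : M.W → M'.W → Prop) : Prop where
  nonempty : ∃ w w', B w w'
  nom_iff : ∀ w w', B w w' → ∀ i : Nom, (M.nomI i = w ↔ M'.nomI (φ.nom i) = w')
  elem_equiv : ∀ w w', B w w' → ∀ p : P, M.val w p = M'.val w' (φ.sig p)
  nom_rel : ∀ i : Nom, B (M.nomI i) (M'.nomI (φ.nom i))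
  forth : ∀ {n : ℕ} (l : Λ n) (w : M.W) (w' : M'.W) (ws : Fin n → M.W),
    B w w' → M.rel l w ws →
    ∃ ws' : Fin n → M'.W, (∀ k, B (ws k) (ws' k)) ∧ M'.rel (φ.ms l) w' ws'
  back : ∀ {n : ℕ} (l : Λ n) (w : M.W) (w' : M'.W) (ws' : Fin n → M'.W),
    B w w' → M'.rel (φ.ms l) w' ws' →
    ∃ ws : Fin n → M.W, (∀ k, B (ws k) (ws' k)) ∧ M.rel l w ws

theorem PLSat_PLTrans {P P' : Type} (φ : P → P') (m : P → Bool) (m' : P' → Bool)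
    (h : ∀ p, m p = m' (φ p)) (ρ : PLForm P) :
    PLSat m ρ ↔ PLSat m' (PLTrans φ ρ) := by
  induction ρ <;> simp_all [PLSat, PLTrans]

/-- Local satisfaction is invariant under bisimulation. -/
theorem IsHPLBisim.sat_iff {P Nom : Type} {Λ : ℕ → Type}
    {P' Nom' : Type} {Λ' : ℕ → Type} {φ : HPLMor P Nom Λ P' Nom' Λ'}
    {M : HPLModel P Nom Λ} {M' : HPLModel P' Nom' Λ'}
    {B : M.W → M'.W → Prop} (hB : IsHPLBisim φ M M' B) (ρ : HPLSent P Nom Λ) :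
    ∀ {w : M.W} {w' : M'.W}, B w w' → (HPLSat M w ρ ↔ HPLSat M' w' (HPLTrans φ ρ)) := by
  induction ρ with
  | base ρ =>
    intro w w' h
    exact PLSat_PLTrans φ.sig _ _ (hB.elem_equiv w w' h) ρ
  | nom i =>
    intro w w' h
    exact hB.nom_iff w w' h i
  | neg a iha =>
    intro w w' h
    exact not_congr (iha h)
  | or a b iha ihb =>
    intro w w' h
    exact or_congr (iha h) (ihb h)
  | and a b iha ihb =>
    intro w w' h
    exact and_congr (iha h) (ihb h)
  | imp a b iha ihb =>
    intro w w' h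
    exact imp_congr (iha h) (ihb h)
  | dia l ξ ih =>
    intro w w' h
    simp only [HPLSat, HPLTrans]
    constructor
    · rintro ⟨ws, hr, hs⟩
      obtain ⟨ws', hb, hr'⟩ := hB.forth l w w' ws h hr
      exact ⟨ws', hr', fun k => (ih k (hb k)).1 (hs k)⟩
    · rintro ⟨ws', hr', hs⟩
      obtain ⟨ws, hb, hr⟩ := hB.back l w w' ws' h hr'
      exact ⟨ws, hr, fun k => (ih k (hb k)).2 (hs k)⟩
  | box l ξ ih =>
    intro w w' h
    simp only [HPLSat, HPLTrans]
    constructor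
    · intro H ws' hr'
      obtain ⟨ws, hb, hr⟩ := hB.back l w w' ws' h hr'
      obtain ⟨k, hk⟩ := H ws hr
      exact ⟨k, (ih k (hb k)).1 hk⟩
    · intro H ws hr
      obtain ⟨ws', hb, hr'⟩ := hB.forth l w w' ws h hr
      obtain ⟨k, hk⟩ := H ws' hr'
      exact ⟨k, (ih k (hb k)).2 hk⟩
  | _ i a iha =>
    intro w w' _
    exact iha (hB.nom_rel i)

/-- Global satisfaction is invariant under total surjective
bisimulation in hybridised propositional logic (instance of the paper's
Corollary 2). -/
theorem HPL_global_bisimulation_invariance {P Nom : Type} {Λ : ℕ → Type}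
    {P' Nom' : Type} {Λ' : ℕ → Type} (φ : HPLMor P Nom Λ P' Nom' Λ')
    (M : HPLModel P Nom Λ) (M' : HPLModel P' Nom' Λ')
    (B : M.W → M'.W → Prop) (hB : IsHPLBisim φ M M' B)
    (htotal : ∀ w : M.W, ∃ w' : M'.W, B w w')
    (hsurj : ∀ w' : M'.W, ∃ w : M.W, B w w') :
    ∀ ρ : HPLSent P Nom Λ, (HPLGSat M ρ ↔ HPLGSat M' (HPLTrans φ ρ)) := by
  intro ρ
  constructor
  · intro H w'
    obtain ⟨w, h⟩ := hsurj w'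
    exact (hB.sat_iff ρ h).1 (H w)
  · intro H w
    obtain ⟨w', h⟩ := htotal w
    exact (hB.sat_iff ρ h).2 (H w')
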